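/- Let n = 2 and s ≥ 5, so the points lie on a smooth conic. Suppose L = L_{2,d}(m_1,…,m_s) is nonzero (effective) and non-redundant (m_i ≥ k_C for every i). Then dim L = G, where G := C(d+2,2) − Σ_{i=1}^s C(m_i+1,2) + Σ_{1≤i<j≤s} C(k_{ij},2) + C(k_C,2) + (s−5)·C(k_C+1,2) − ε·C(k_C,1) and k_{ij} := m_i + m_j − d. -/

import Mathlib

open Finset

noncomputable section

/-- Binomial coefficient `C(a,k)` with integer arguments; zero if `k < 0` or `a < k`. -/
def Cb (a k : ℤ) : ℤ := if 0 ≤ k ∧ k ≤ a then (Nat.choose a.toNat k.toNat : ℤ) else 0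

/-- Iterated partial derivative along a list of coordinate directions, as a linear map. -/
def derivAlong {n : ℕ} (D : List (Fin (n+1))) :
    MvPolynomial (Fin (n+1)) ℂ →ₗ[ℂ] MvPolynomial (Fin (n+1)) ℂ :=
  D.foldr (fun j f => (MvPolynomial.pderiv j).toLinearMap.comp f) LinearMap.id

/-- The point `(1, u, u², …, uⁿ) ∈ ℂ^{n+1}` on the affine cone over the
rational normal curve of degree `n`. -/
def rncPoint (n : ℕ) (u : ℂ) : Fin (n+1) → ℂ := fun j => u ^ (j : ℕ)

/-- The linear system `L_{n,d}(m_1,…,m_s)`: homogeneous polynomials of degree `d`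
in `x_0,…,x_n` all of whose partial derivatives of total order `≤ m_i − 1`
vanish at the point `p_i = (1, t_i, …, t_iⁿ)`. -/
def linSys (n d s : ℕ) (m : Fin s → ℕ) (tp : Fin s → ℂ) :
    Submodule ℂ (MvPolynomial (Fin (n+1)) ℂ) :=
  MvPolynomial.homogeneousSubmodule (Fin (n+1)) ℂ d ⊓
    ⨅ (i : Fin s), ⨅ (D : List (Fin (n+1))), ⨅ (_ : D.length < m i),
      LinearMap.ker
        ((MvPolynomial.aeval (rncPoint n (tp i))).toLinearMap.comp (derivAlong D))

/-- `k_C = ⌈(m_1+⋯+m_s − nd)/(s−n−2)⌉`. -/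
def kC (n d s : ℕ) (m : Fin s → ℕ) : ℤ :=
  ⌈((∑ i, (m i : ℚ)) - (n : ℚ) * d) / ((s : ℚ) - n - 2)⌉


open MvPolynomial in
/-- Vanishing to order `m` at `p`. -/
def VO (p : Fin 3 → ℂ) : ℕ → MvPolynomial (Fin 3) ℂ → Prop
  | 0, _ => True
  | m + 1, f => MvPolynomial.eval p f = 0 ∧ ∀ j, VO p m (MvPolynomial.pderiv j f)

theorem pderiv_comm' (i j : Fin 3) (f : MvPolynomial (Fin 3) ℂ) :
    MvPolynomial.pderiv i (MvPolynomial.pderiv j f) = MvPolynomial.pderiv j (MvPolynomial.pderiv i f) := by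
  have h : ⁅(MvPolynomial.pderiv i : Derivation ℂ (MvPolynomial (Fin 3) ℂ) (MvPolynomial (Fin 3) ℂ)), (MvPolynomial.pderiv j : Derivation ℂ (MvPolynomial (Fin 3) ℂ) (MvPolynomial (Fin 3) ℂ))⁆ = 0 := by
    apply MvPolynomial.derivation_ext
    intro k
    rw [Derivation.commutator_apply, MvPolynomial.pderiv_X, MvPolynomial.pderiv_X]
    simp only [Pi.single_apply]
    split_ifs <;> simp
  have h2 := congrArg (fun D : Derivation ℂ (MvPolynomial (Fin 3) ℂ) (MvPolynomial (Fin 3) ℂ) => D f) h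
  simp only [Derivation.commutator_apply] at h2
  exact sub_eq_zero.1 h2

theorem derivAlong_pderiv (D : List (Fin 3)) (j : Fin 3) (f : MvPolynomial (Fin 3) ℂ) :
    derivAlong (n := 2) D (MvPolynomial.pderiv j f) = MvPolynomial.pderiv j (derivAlong (n := 2) D f) := by
  induction D with
  | nil => simp [derivAlong]
  | cons k D ih =>
    have h : ∀ g, derivAlong (n := 2) (k :: D) g = MvPolynomial.pderiv k (derivAlong (n := 2) D g) := by
      intro g; simp [derivAlong]
    rw [h, h, ih, pderiv_comm']

theorem derivAlong_cons (D : List (Fin 3)) (k : Fin 3) (g : MvPolynomial (Fin 3) ℂ) :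
    derivAlong (n := 2) (k :: D) g = MvPolynomial.pderiv k (derivAlong (n := 2) D g) := by
  simp [derivAlong]

theorem VO_iff (p : Fin 3 → ℂ) (m : ℕ) (f : MvPolynomial (Fin 3) ℂ) :
    VO p m f ↔ ∀ D : List (Fin 3), D.length < m → MvPolynomial.eval p (derivAlong (n := 2) D f) = 0 := by
  induction m generalizing f with
  | zero => simp [VO]
  | succ m ih =>
    simp only [VO, ih]
    constructor
    · rintro ⟨h0, h⟩ D hD
      cases D with
      | nil => simpa [derivAlong] using h0
      | cons k D =>
        rw [derivAlong_cons, ← derivAlong_pderiv]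
        exact h k D (by simpa using hD)
    · intro h
      refine ⟨by simpa [derivAlong] using h [] (by simp), fun j D hD => ?_⟩
      rw [derivAlong_pderiv, ← derivAlong_cons]
      exact h _ (by simpa using hD)

theorem VO_zero (p : Fin 3 → ℂ) (m : ℕ) : VO p m 0 := by
  induction m with
  | zero => trivial
  | succ m ih => exact ⟨by simp, fun j => by simpa using ih⟩

theorem VO_add {p : Fin 3 → ℂ} {m : ℕ} {f g : MvPolynomial (Fin 3) ℂ} (hf : VO p m f) (hg : VO p m g) :
    VO p m (f + g) := by
  induction m generalizing f g with
  | zero => trivial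
  | succ m ih => exact ⟨by simp [hf.1, hg.1], fun j => by simpa using ih (hf.2 j) (hg.2 j)⟩

theorem VO_mono {p : Fin 3 → ℂ} {m : ℕ} {f : MvPolynomial (Fin 3) ℂ} (hf : VO p (m+1) f) : VO p m f := by
  induction m generalizing f with
  | zero => trivial
  | succ m ih => exact ⟨hf.1, fun j => ih (hf.2 j)⟩

theorem VO_mul {p : Fin 3 → ℂ} {m : ℕ} (f : MvPolynomial (Fin 3) ℂ) {g : MvPolynomial (Fin 3) ℂ}
    (hg : VO p m g) : VO p m (f * g) := by
  induction m generalizing f g with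
  | zero => trivial
  | succ m ih =>
    refine ⟨by simp [hg.1], fun j => ?_⟩
    rw [Derivation.leibniz, smul_eq_mul, smul_eq_mul, mul_comm g]
    exact VO_add (ih _ (hg.2 j)) (ih _ (VO_mono hg))

theorem VO_neg {p : Fin 3 → ℂ} {m : ℕ} {f : MvPolynomial (Fin 3) ℂ} (hf : VO p m f) : VO p m (-f) := by
  have := VO_mul (-1) hf
  simpa using this

theorem VO_sub {p : Fin 3 → ℂ} {m : ℕ} {f g : MvPolynomial (Fin 3) ℂ} (hf : VO p m f) (hg : VO p m g) :
    VO p m (f - g) := by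
  rw [sub_eq_add_neg]; exact VO_add hf (VO_neg hg)

theorem VO_mul_succ {p : Fin 3 → ℂ} {m : ℕ} {P : MvPolynomial (Fin 3) ℂ} (hP : MvPolynomial.eval p P = 0)
    {g : MvPolynomial (Fin 3) ℂ}
    (hg : VO p m g) : VO p (m + 1) (P * g) := by
  induction m generalizing g with
  | zero => exact ⟨by simp [hP], fun j => trivial⟩
  | succ m ih =>
    refine ⟨by simp [hP], fun j => ?_⟩
    rw [Derivation.leibniz, smul_eq_mul, smul_eq_mul, mul_comm g]
    exact VO_add (ih (hg.2 j)) (VO_mul _ hg)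

theorem VO_of_mul {p : Fin 3 → ℂ} {m : ℕ} {P g : MvPolynomial (Fin 3) ℂ} (hP : MvPolynomial.eval p P ≠ 0)
    (h : VO p m (P * g)) : VO p m g := by
  induction m generalizing g with
  | zero => trivial
  | succ m ih =>
    have hg := ih (VO_mono h)
    have h0 := h.1
    rw [map_mul] at h0
    refine ⟨(mul_eq_zero.1 h0).resolve_left hP, fun j => ih ?_⟩
    have h1 := h.2 j
    rw [Derivation.leibniz, smul_eq_mul, smul_eq_mul, mul_comm g] at h1
    have := VO_sub h1 (VO_mul (MvPolynomial.pderiv j P) hg)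
    simpa using this

theorem VO_key {p : Fin 3 → ℂ} (k : Fin 3) {P : MvPolynomial (Fin 3) ℂ} (hP0 : MvPolynomial.eval p P = 0)
    (hP : MvPolynomial.eval p (MvPolynomial.pderiv k P) ≠ 0) (m : ℕ) :
    ∀ (N : ℕ) (g : MvPolynomial (Fin 3) ℂ), VO p m g →
      VO p (m+1) (((N : MvPolynomial (Fin 3) ℂ) + 1) * MvPolynomial.pderiv k P * g
        + P * MvPolynomial.pderiv k g) → VO p (m+1) g := by
  have hne : ∀ N : ℕ, MvPolynomial.eval p (((N : MvPolynomial (Fin 3) ℂ) + 1) * MvPolynomial.pderiv k P) ≠ 0 := by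
    intro N
    simp only [map_mul, map_add, map_natCast, map_one]
    exact mul_ne_zero (by exact_mod_cast Nat.succ_ne_zero N) hP
  induction m with
  | zero =>
    intro N g _ h
    have h0 := h.1
    rw [map_add, map_mul, map_mul _ P, hP0, zero_mul, add_zero] at h0
    exact ⟨(mul_eq_zero.1 h0).resolve_left (hne N), fun _ => trivial⟩
  | succ m ih =>
    intro N g hg h
    have h1 := h.2 k
    have h2 : VO p (m+1) (MvPolynomial.pderiv k g) := by
      refine ih (N+1) _ (hg.2 k) ?_
      have h3 := VO_sub h1 (VO_mul (((N : MvPolynomial (Fin 3) ℂ) + 1) *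
        MvPolynomial.pderiv k (MvPolynomial.pderiv k P)) hg)
      convert h3 using 1
      simp only [map_add, Derivation.leibniz, smul_eq_mul, Derivation.map_natCast, Derivation.map_one_eq_zero]
      push_cast
      ring
    have h4 := VO_sub h (VO_mul_succ hP0 h2)
    exact VO_of_mul (hne N) (by simpa using h4)

theorem VO_div {p : Fin 3 → ℂ} (k : Fin 3) {P : MvPolynomial (Fin 3) ℂ} (hP0 : MvPolynomial.eval p P = 0)
    (hP : MvPolynomial.eval p (MvPolynomial.pderiv k P) ≠ 0) (m : ℕ) (g : MvPolynomial (Fin 3) ℂ)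
    (h : VO p (m+1) (P * g)) : VO p m g := by
  induction m with
  | zero => trivial
  | succ m ih =>
    refine VO_key k hP0 hP m 0 g (ih (VO_mono h)) ?_
    have := h.2 k
    convert this using 1
    simp only [Derivation.leibniz, smul_eq_mul]
    push_cast
    ring

theorem mem_linSys {d s : ℕ} {m : Fin s → ℕ} {tp : Fin s → ℂ} {f : MvPolynomial (Fin 3) ℂ} :
    f ∈ linSys 2 d s m tp ↔ f.IsHomogeneous d ∧ ∀ i, VO (rncPoint 2 (tp i)) (m i) f := by
  simp only [linSys, Submodule.mem_inf, Submodule.mem_iInf, MvPolynomial.mem_homogeneousSubmodule, VO_iff]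
  rfl

theorem poly_pow_dvd {F : Polynomial ℂ} {t : ℂ} {m : ℕ} (h0 : F.eval t = 0)
    (h : (Polynomial.X - Polynomial.C t) ^ m ∣ Polynomial.derivative F) :
    (Polynomial.X - Polynomial.C t) ^ (m + 1) ∣ F := by
  by_cases hF : F = 0
  · simp [hF]
  by_cases hF' : Polynomial.derivative F = 0
  · have := Polynomial.derivative_eq_zero.1 hF'
    rw [Polynomial.eq_C_of_natDegree_eq_zero this] at h0 hF
    simp at h0 hF
    exact absurd h0 hF
  have h1 := Polynomial.derivative_rootMultiplicity_of_root (p := F) (t := t) h0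
  have h2 := (Polynomial.le_rootMultiplicity_iff hF').2 h
  have h3 := (Polynomial.rootMultiplicity_pos hF).2 h0
  exact (Polynomial.le_rootMultiplicity_iff hF).1 (by omega)

theorem derivative_aeval (γ : Fin 3 → Polynomial ℂ) (f : MvPolynomial (Fin 3) ℂ) :
    Polynomial.derivative (MvPolynomial.aeval γ f) =
      ∑ j, MvPolynomial.aeval γ (MvPolynomial.pderiv j f) * Polynomial.derivative (γ j) := by
  induction f using MvPolynomial.induction_on with
  | C a => simp
  | add f g hf hg => simp [hf, hg, add_mul, Finset.sum_add_distrib]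
  | mul_X f i hf =>
    have h1 : ∀ j, MvPolynomial.aeval γ (MvPolynomial.pderiv j (f * MvPolynomial.X i)) =
        MvPolynomial.aeval γ (MvPolynomial.pderiv j f) * γ i
          + MvPolynomial.aeval γ f * (if j = i then 1 else 0) := by
      intro j
      rw [MvPolynomial.pderiv_mul, map_add, map_mul, map_mul, MvPolynomial.aeval_X, MvPolynomial.pderiv_X]
      congr 2
      simp only [Pi.single_apply, eq_comm (a := i)]
      split_ifs <;> simp
    have h2 : ∀ j, MvPolynomial.aeval γ (MvPolynomial.pderiv j (f * MvPolynomial.X i)) * Polynomial.derivative (γ j) =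
        (MvPolynomial.aeval γ (MvPolynomial.pderiv j f) * Polynomial.derivative (γ j)) * γ i
          + (if j = i then MvPolynomial.aeval γ f * Polynomial.derivative (γ j) else 0) := by
      intro j
      rw [h1]
      split_ifs <;> ring
    rw [Finset.sum_congr rfl fun j _ => h2 j, Finset.sum_add_distrib, ← Finset.sum_mul, ← hf,
      map_mul, MvPolynomial.aeval_X, Polynomial.derivative_mul]
    simp

theorem eval_aeval (γ : Fin 3 → Polynomial ℂ) (f : MvPolynomial (Fin 3) ℂ) (t : ℂ) :
    (MvPolynomial.aeval γ f).eval t = MvPolynomial.eval (fun j => (γ j).eval t) f := by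
  induction f using MvPolynomial.induction_on with
  | C a => simp
  | add f g hf hg => simp [hf, hg]
  | mul_X f i hf => simp [hf]

theorem VO_curve {γ : Fin 3 → Polynomial ℂ} {t : ℂ} {m : ℕ} {f : MvPolynomial (Fin 3) ℂ}
    (h : VO (fun j => (γ j).eval t) m f) :
    (Polynomial.X - Polynomial.C t) ^ m ∣ MvPolynomial.aeval γ f := by
  induction m generalizing f with
  | zero => simp
  | succ m ih =>
    apply poly_pow_dvd
    · rw [eval_aeval]; exact h.1
    · rw [derivative_aeval]
      exact Finset.dvd_sum fun j _ => Dvd.dvd.mul_right (ih (h.2 j)) _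

theorem natDegree_aeval_le {γ : Fin 3 → Polynomial ℂ} {e d : ℕ} (hγ : ∀ j, (γ j).natDegree ≤ e)
    {f : MvPolynomial (Fin 3) ℂ} (hf : f.IsHomogeneous d) :
    (MvPolynomial.aeval γ f).natDegree ≤ e * d := by
  rw [MvPolynomial.aeval_def, MvPolynomial.eval₂_eq']
  refine Polynomial.natDegree_sum_le_of_forall_le _ _ fun c hc => ?_
  have hd := hf.degree_eq_sum_deg_support hc
  refine (Polynomial.natDegree_C_mul_le _ _).trans ((Polynomial.natDegree_prod_le _ _).trans ?_)
  have : d = ∑ i, c i := by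
    rw [hd, Finset.sum_subset (Finset.subset_univ _)]
    intro x _ hx; simpa using hx
  rw [this, Finset.mul_sum]
  refine Finset.sum_le_sum fun j _ => Polynomial.natDegree_pow_le.trans ?_
  rw [mul_comm]; exact Nat.mul_le_mul_right _ (hγ j)

theorem eval_smul_hom {f : MvPolynomial (Fin 3) ℂ} {d : ℕ} (hf : f.IsHomogeneous d) (c : ℂ) (x : Fin 3 → ℂ) :
    MvPolynomial.eval (fun j => c * x j) f = c ^ d * MvPolynomial.eval x f := by
  rw [MvPolynomial.eval_eq', MvPolynomial.eval_eq', Finset.mul_sum]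
  refine Finset.sum_congr rfl fun a ha => ?_
  have hd := hf.degree_eq_sum_deg_support ha
  have : d = ∑ i, a i := by
    rw [hd, Finset.sum_subset (Finset.subset_univ _)]
    intro x _ hx; simpa using hx
  simp only [mul_pow, Finset.prod_mul_distrib]
  rw [Finset.prod_pow_eq_pow_sum, ← this]; ring

/-- The curve data: an irreducible form with a parametrization. -/
structure CurveData (s : ℕ) (tp : Fin s → ℂ) (e : ℕ) (S : Finset (Fin s)) where
  P : MvPolynomial (Fin 3) ℂ
  γ : Fin 3 → Polynomial ℂ
  hom : P.IsHomogeneous e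
  irr : Irreducible P
  ndvd : ¬ P ∣ MvPolynomial.X 0
  par : ∀ x : Fin 3 → ℂ, x 0 ≠ 0 → MvPolynomial.eval x P = 0 → ∃ u, ∀ j, x j = x 0 * (γ j).eval u
  deg : ∀ j, (γ j).natDegree ≤ e
  pt : ∀ i ∈ S, (fun j => (γ j).eval (tp i)) = rncPoint 2 (tp i)
  ev : ∀ i ∈ S, MvPolynomial.eval (rncPoint 2 (tp i)) P = 0
  der : ∀ i ∈ S, MvPolynomial.eval (rncPoint 2 (tp i)) (MvPolynomial.pderiv 2 P) ≠ 0
  nev : ∀ i, i ∉ S → MvPolynomial.eval (rncPoint 2 (tp i)) P ≠ 0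

theorem CurveData.dvd {s : ℕ} {tp : Fin s → ℂ} {e : ℕ} {S : Finset (Fin s)} (c : CurveData s tp e S)
    {f : MvPolynomial (Fin 3) ℂ} {d : ℕ} (hf : f.IsHomogeneous d) (h : MvPolynomial.aeval c.γ f = 0) :
    c.P ∣ f := by
  have hp : Prime c.P := c.irr.prime
  have hI : (Ideal.span {c.P}).IsPrime := (Ideal.span_singleton_prime hp.ne_zero).2 hp
  have : MvPolynomial.X 0 * f ∈ MvPolynomial.vanishingIdeal ℂ (MvPolynomial.zeroLocus ℂ (Ideal.span {c.P})) := by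
    rw [MvPolynomial.mem_vanishingIdeal_iff]
    intro x hx
    rw [MvPolynomial.mem_zeroLocus_iff] at hx
    have hx := hx c.P (Ideal.mem_span_singleton_self _)
    rw [MvPolynomial.aeval_eq_eval] at hx ⊢
    by_cases h0 : x 0 = 0
    · simp [h0]
    · obtain ⟨u, hu⟩ := c.par x h0 hx
      have : x = fun j => x 0 * (c.γ j).eval u := funext hu
      have h2 : MvPolynomial.eval x f = 0 := by
        rw [this, eval_smul_hom hf, ← eval_aeval, h]; simp
      change MvPolynomial.eval x _ = 0
      rw [map_mul, h2, mul_zero]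
  rw [MvPolynomial.vanishingIdeal_zeroLocus_eq_radical, hI.radical, Ideal.mem_span_singleton] at this
  exact (hp.dvd_or_dvd this).resolve_left c.ndvd

theorem hom_div {P f : MvPolynomial (Fin 3) ℂ} {e d : ℕ} (hP : P.IsHomogeneous e) (hf : f.IsHomogeneous d)
    (hf0 : f ≠ 0) (h : P ∣ f) : e ≤ d ∧ ∃ g : MvPolynomial (Fin 3) ℂ, g.IsHomogeneous (d - e) ∧ f = P * g := by
  obtain ⟨g, rfl⟩ := h
  let _ : GradedAlgebra (MvPolynomial.homogeneousSubmodule (Fin 3) ℂ) := MvPolynomial.gradedAlgebra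
  have h1 := DirectSum.decompose_of_mem_same (MvPolynomial.homogeneousSubmodule (Fin 3) ℂ) hf
  by_cases hed : e ≤ d
  · refine ⟨hed, _, (DirectSum.decompose (MvPolynomial.homogeneousSubmodule (Fin 3) ℂ) g (d - e)).2, ?_⟩
    rw [← DirectSum.coe_decompose_mul_of_left_mem_of_le _ hP hed, h1]
  · rw [DirectSum.coe_decompose_mul_of_left_mem_of_not_le _ hP hed] at h1
    exact absurd h1.symm hf0

/-- Multiplicities lowered by one on `S`. -/
def redu {s : ℕ} (S : Finset (Fin s)) (m : Fin s → ℕ) : Fin s → ℕ := fun i => if i ∈ S then m i - 1 else m i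

instance finDim_linSys (d s : ℕ) (m : Fin s → ℕ) (tp : Fin s → ℂ) :
    FiniteDimensional ℂ (linSys 2 d s m tp) := by
  have h : FiniteDimensional ℂ (MvPolynomial.homogeneousSubmodule (Fin 3) ℂ d) :=
    Module.Finite.iff_fg.2 (MvPolynomial.homogeneousSubmodule_fg _ _ d)
  exact Submodule.finiteDimensional_of_le (S₂ := MvPolynomial.homogeneousSubmodule (Fin 3) ℂ d) inf_le_left

section curve
variable {s : ℕ} {tp : Fin s → ℂ} {e : ℕ} {S : Finset (Fin s)}

theorem CurveData.mem_div (c : CurveData s tp e S) {d : ℕ} {m : Fin s → ℕ} {f : MvPolynomial (Fin 3) ℂ}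
    (hf : f ∈ linSys 2 d s m tp) (hf0 : f ≠ 0) (h : MvPolynomial.aeval c.γ f = 0) :
    e ≤ d ∧ ∃ g ∈ linSys 2 (d - e) s (redu S m) tp, f = c.P * g := by
  rw [mem_linSys] at hf
  obtain ⟨hed, g, hg, rfl⟩ := hom_div c.hom hf.1 hf0 (c.dvd hf.1 h)
  refine ⟨hed, g, mem_linSys.2 ⟨hg, fun i => ?_⟩, rfl⟩
  have hi := hf.2 i
  simp only [redu]
  split_ifs with hS
  · rcases Nat.eq_zero_or_pos (m i) with h0 | h0
    · rw [h0]; trivial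
    · apply VO_div 2 (c.ev i hS) (c.der i hS)
      rwa [Nat.sub_add_cancel h0]
  · exact VO_of_mul (c.nev i hS) hi

theorem CurveData.mul_mem (c : CurveData s tp e S) {d : ℕ} (hed : e ≤ d) {m : Fin s → ℕ}
    {g : MvPolynomial (Fin 3) ℂ}
    (hg : g ∈ linSys 2 (d - e) s (redu S m) tp) : c.P * g ∈ linSys 2 d s m tp := by
  rw [mem_linSys] at hg ⊢
  refine ⟨?_, fun i => ?_⟩
  · have := c.hom.mul hg.1
    rwa [Nat.add_sub_cancel' hed] at this
  · have hi := hg.2 i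
    simp only [redu] at hi
    split_ifs at hi with hS
    · rcases Nat.eq_zero_or_pos (m i) with h0 | h0
      · rw [h0]; trivial
      · have := VO_mul_succ (c.ev i hS) hi
        rwa [Nat.sub_add_cancel h0] at this
    · exact VO_mul _ hi

theorem CurveData.prod_dvd (c : CurveData s tp e S) (htp : Function.Injective tp) {d : ℕ} {m : Fin s → ℕ}
    {f : MvPolynomial (Fin 3) ℂ} (hf : f ∈ linSys 2 d s m tp) :
    ∏ i ∈ S, (Polynomial.X - Polynomial.C (tp i)) ^ m i ∣ MvPolynomial.aeval c.γ f := by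
  refine Finset.prod_dvd_of_coprime ?_ ?_
  · intro i _ j _ hij
    exact (Polynomial.pairwise_coprime_X_sub_C htp hij).pow
  · intro i hi
    apply VO_curve
    rw [c.pt i hi]
    exact (mem_linSys.1 hf).2 i

theorem CurveData.upper (c : CurveData s tp e S) (htp : Function.Injective tp) (d : ℕ) (m : Fin s → ℕ) :
    Module.finrank ℂ (linSys 2 d s m tp) ≤
      Module.finrank ℂ (linSys 2 (d - e) s (redu S m) tp) + (e * d + 1 - ∑ i ∈ S, m i) := by
  set A : Polynomial ℂ := ∏ i ∈ S, (Polynomial.X - Polynomial.C (tp i)) ^ m i with hA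
  have hAm : A.Monic := Polynomial.monic_prod_of_monic _ _ fun i _ => (Polynomial.monic_X_sub_C _).pow _
  have hAd : A.natDegree = ∑ i ∈ S, m i := by
    rw [hA, Polynomial.natDegree_prod_of_monic _ _ fun i _ => (Polynomial.monic_X_sub_C _).pow _]
    simp
  set N := e * d + 1 - ∑ i ∈ S, m i with hN
  let r : linSys 2 d s m tp →ₗ[ℂ] Polynomial ℂ :=
    (MvPolynomial.aeval c.γ).toLinearMap ∘ₗ (linSys 2 d s m tp).subtype
  have hr : ∀ f, r f = MvPolynomial.aeval c.γ (f : MvPolynomial (Fin 3) ℂ) := fun f => rfl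
  have h1 : LinearMap.range r ≤ (Polynomial.degreeLT ℂ N).map (LinearMap.mulLeft ℂ A) := by
    rintro _ ⟨f, rfl⟩
    obtain ⟨q, hq⟩ := c.prod_dvd htp f.2
    rw [← hA] at hq
    refine ⟨q, ?_, by rw [hr, hq]; rfl⟩
    change q ∈ Polynomial.degreeLT ℂ N
    rw [Polynomial.mem_degreeLT]
    by_cases hq0 : q = 0
    · rw [hq0, Polynomial.degree_zero]; exact WithBot.bot_lt_coe _
    · have hd := natDegree_aeval_le c.deg (mem_linSys.1 f.2).1
      rw [hq, hAm.natDegree_mul' hq0, hAd] at hd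
      rw [Polynomial.degree_eq_natDegree hq0]
      exact_mod_cast (by omega : q.natDegree < N)
  have hdN : Module.finrank ℂ (Polynomial.degreeLT ℂ N) = N := by
    rw [(Polynomial.degreeLTEquiv ℂ N).finrank_eq]; simp
  have hfN : FiniteDimensional ℂ (Polynomial.degreeLT ℂ N) :=
    (Polynomial.degreeLTEquiv ℂ N).symm.finiteDimensional
  have h2 : Module.finrank ℂ (LinearMap.range r) ≤ N := by
    refine (Submodule.finrank_mono h1).trans ?_
    refine (Submodule.finrank_map_le _ _).trans hdN.le
  have h3 : (LinearMap.ker r).map (linSys 2 d s m tp).subtype ≤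
      (linSys 2 (d - e) s (redu S m) tp).map (LinearMap.mulLeft ℂ c.P) := by
    rintro _ ⟨f, hf, rfl⟩
    by_cases hf0 : (f : MvPolynomial (Fin 3) ℂ) = 0
    · rw [Submodule.subtype_apply, hf0]; exact zero_mem _
    · obtain ⟨_, g, hg, h⟩ := c.mem_div f.2 hf0 hf
      exact ⟨g, hg, by rw [Submodule.subtype_apply, h]; rfl⟩
  have h4 : Module.finrank ℂ (LinearMap.ker r) ≤ Module.finrank ℂ (linSys 2 (d - e) s (redu S m) tp) := by
    rw [← Submodule.finrank_map_subtype_eq]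
    exact (Submodule.finrank_mono h3).trans (Submodule.finrank_map_le _ _)
  have h5 := LinearMap.finrank_range_add_finrank_ker r
  omega

theorem CurveData.equal (c : CurveData s tp e S) (htp : Function.Injective tp) (d : ℕ) (m : Fin s → ℕ)
    (heff : linSys 2 d s m tp ≠ ⊥) (hlt : e * d < ∑ i ∈ S, m i) :
    e ≤ d ∧ linSys 2 (d - e) s (redu S m) tp ≠ ⊥ ∧
    Module.finrank ℂ (linSys 2 d s m tp) = Module.finrank ℂ (linSys 2 (d - e) s (redu S m) tp) := by
  obtain ⟨f, hf, hf0⟩ := Submodule.exists_mem_ne_zero_of_ne_bot heff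
  have hz : MvPolynomial.aeval c.γ f = 0 := by
    refine Polynomial.eq_zero_of_dvd_of_natDegree_lt (c.prod_dvd htp hf) ?_
    rw [Polynomial.natDegree_prod_of_monic _ _ fun i _ => (Polynomial.monic_X_sub_C _).pow _]
    refine (natDegree_aeval_le c.deg (mem_linSys.1 hf).1).trans_lt ?_
    simpa using hlt
  obtain ⟨hed, g, hg, rfl⟩ := c.mem_div hf hf0 hz
  refine ⟨hed, ?_, le_antisymm ?_ ?_⟩
  · intro hb
    rw [hb, Submodule.mem_bot] at hg
    exact hf0 (by rw [hg, mul_zero])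
  · have := c.upper htp d m
    omega
  · have hinj : Function.Injective (LinearMap.mulLeft ℂ c.P) :=
      fun a b h => mul_left_cancel₀ c.irr.ne_zero h
    refine ((Submodule.equivMapOfInjective _ hinj _).finrank_eq).trans_le ?_
    apply Submodule.finrank_mono
    rintro _ ⟨g, hg, rfl⟩
    exact c.mul_mem hed hg
end curve

open MvPolynomial in
theorem not_dvd_X0 {P : MvPolynomial (Fin 3) ℂ} (x : Fin 3 → ℂ) (hx : x 0 ≠ 0) (hP : eval x P = 0) :
    ¬ P ∣ X 0 := by
  rintro ⟨g, hg⟩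
  have := congrArg (eval x) hg
  rw [map_mul, hP, zero_mul, eval_X] at this
  exact hx this

open MvPolynomial in
/-- The conic. -/
def conicData (s : ℕ) (tp : Fin s → ℂ) : CurveData s tp 2 Finset.univ where
  P := X 0 * X 2 + (- X 1 ^ 2)
  γ := ![1, Polynomial.X, Polynomial.X ^ 2]
  hom := ((isHomogeneous_X ℂ 0).mul (isHomogeneous_X ℂ 2)).add (isHomogeneous_X_pow 1 2).neg
  irr := by
    apply irreducible_mul_X_add
    · exact X_ne_zero 0
    · simp
    · rw [vars_neg]
      intro h
      have := vars_pow _ _ h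
      simp at this
    · rw [IsRelPrime.neg_right_iff]
      apply IsRelPrime.pow_right
      rw [(X_prime (R := ℂ) (i := (0 : Fin 3))).irreducible.isRelPrime_iff_not_dvd]
      rw [X_dvd_X]
      simp
  ndvd := not_dvd_X0 ![1, 0, 0] (by simp) (by simp)
  par := by
    intro x h0 h
    simp at h
    refine ⟨x 1 / x 0, fun j => ?_⟩
    fin_cases j
    · simp
    · simp; field_simp
    · simp; field_simp; linear_combination h
  deg := by intro j; fin_cases j <;> simp
  pt := by
    intro i _
    funext j
    fin_cases j <;> simp [rncPoint]
  ev := by intro i _; simp [rncPoint]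
  der := by intro i _; simp [rncPoint, pderiv_X]
  nev := by simp

open MvPolynomial in
/-- The line through two of the points. -/
def lineData {s : ℕ} {tp : Fin s → ℂ} (htp : Function.Injective tp) (i j : Fin s) :
    CurveData s tp 1 {i, j} where
  P := 1 * X 2 + (C (tp i * tp j) * X 0 - C (tp i + tp j) * X 1)
  γ := ![1, Polynomial.X, Polynomial.C (tp i + tp j) * Polynomial.X - Polynomial.C (tp i * tp j)]
  hom := by
    rw [one_mul]
    exact (isHomogeneous_X ℂ 2).add ((isHomogeneous_C_mul_X _ _).sub (isHomogeneous_C_mul_X _ _))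
  irr := by
    apply irreducible_mul_X_add
    · exact one_ne_zero
    · simp
    · intro h
      have h := vars_sub_subset _ h
      rw [Finset.mem_union] at h
      rcases h with h | h <;>
      · have h := vars_mul _ _ h
        rw [vars_C, vars_X] at h
        simp at h
    · exact isRelPrime_one_left
  ndvd := not_dvd_X0 ![1, 0, - (tp i * tp j)] (by simp) (by simp)
  par := by
    intro x h0 h
    simp at h
    refine ⟨x 1 / x 0, fun k => ?_⟩
    fin_cases k
    · simp
    · simp; field_simp
    · simp; field_simp; linear_combination h
  deg := by
    intro k; fin_cases k
    · simp
    · simp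
    · simp only [Fin.reduceFinMk, Matrix.cons_val]; compute_degree
  pt := by
    intro l hl
    funext k
    simp at hl
    fin_cases k
    · simp [rncPoint]
    · simp [rncPoint]
    · rcases hl with rfl | rfl <;> simp [rncPoint] <;> ring
  ev := by
    intro l hl
    simp at hl
    rcases hl with rfl | rfl <;> simp [rncPoint] <;> ring
  der := by intro l _; simp [pderiv_X]
  nev := by
    intro l hl
    simp at hl
    have h : (tp l - tp i) * (tp l - tp j) ≠ 0 :=
      mul_ne_zero (sub_ne_zero.2 fun h => hl.1 (htp h)) (sub_ne_zero.2 fun h => hl.2 (htp h))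
    intro h2
    apply h
    simp [rncPoint] at h2
    linear_combination h2

/-- Vanishing using only the last two directions. -/
def VT (p : Fin 3 → ℂ) : ℕ → MvPolynomial (Fin 3) ℂ → Prop
  | 0, _ => True
  | m + 1, f => MvPolynomial.eval p f = 0 ∧ VT p m (MvPolynomial.pderiv 1 f) ∧ VT p m (MvPolynomial.pderiv 2 f)

theorem VT_mono {p : Fin 3 → ℂ} {m : ℕ} {f : MvPolynomial (Fin 3) ℂ} (hf : VT p (m+1) f) : VT p m f := by
  induction m generalizing f with
  | zero => trivial
  | succ m ih => exact ⟨hf.1, ih hf.2.1, ih hf.2.2⟩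

theorem VO_of_VT {p : Fin 3 → ℂ} (hp : p 0 ≠ 0) {m d : ℕ} {f : MvPolynomial (Fin 3) ℂ} (hf : f.IsHomogeneous d)
    (h : VT p m f) : VO p m f := by
  induction m generalizing f d with
  | zero => trivial
  | succ m ih =>
    have h1 := ih hf.pderiv h.2.1
    have h2 := ih hf.pderiv h.2.2
    have h3 := ih hf (VT_mono h)
    refine ⟨h.1, fun j => ?_⟩
    fin_cases j
    · have he := hf.sum_X_mul_pderiv
      rw [Fin.sum_univ_three] at he
      have : VO p m (MvPolynomial.X 0 * MvPolynomial.pderiv 0 f) := by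
        have h4 := VO_sub (VO_sub (VO_mul (d : MvPolynomial (Fin 3) ℂ) h3)
          (VO_mul (MvPolynomial.X 1) h1)) (VO_mul (MvPolynomial.X 2) h2)
        convert h4 using 1
        rw [← nsmul_eq_mul, ← he]; ring
      exact VO_of_mul (by simpa using hp) this
    · exact h1
    · exact h2

/-- Mixed derivative in the last two directions. -/
def mixD (b c : ℕ) : MvPolynomial (Fin 3) ℂ →ₗ[ℂ] MvPolynomial (Fin 3) ℂ :=
  ((MvPolynomial.pderiv 1).toLinearMap : Module.End ℂ (MvPolynomial (Fin 3) ℂ)) ^ b *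
    ((MvPolynomial.pderiv 2).toLinearMap : Module.End ℂ (MvPolynomial (Fin 3) ℂ)) ^ c

theorem mixD_1 (b c : ℕ) (f : MvPolynomial (Fin 3) ℂ) :
    mixD b c (MvPolynomial.pderiv 1 f) = mixD (b+1) c f := by
  have hc : Commute ((MvPolynomial.pderiv 1).toLinearMap : Module.End ℂ (MvPolynomial (Fin 3) ℂ))
      ((MvPolynomial.pderiv 2).toLinearMap : Module.End ℂ (MvPolynomial (Fin 3) ℂ)) := by
    apply LinearMap.ext
    intro f
    exact pderiv_comm' 1 2 f
  have : mixD b c * ((MvPolynomial.pderiv 1).toLinearMap : Module.End ℂ (MvPolynomial (Fin 3) ℂ)) = mixD (b+1) c := by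
    rw [mixD, mixD, mul_assoc, ← (hc.pow_right c).eq, ← mul_assoc, ← pow_succ]
  rw [← this]; rfl

theorem mixD_2 (b c : ℕ) (f : MvPolynomial (Fin 3) ℂ) :
    mixD b c (MvPolynomial.pderiv 2 f) = mixD b (c+1) f := by
  have : mixD b c * ((MvPolynomial.pderiv 2).toLinearMap : Module.End ℂ (MvPolynomial (Fin 3) ℂ)) = mixD b (c+1) := by
    rw [mixD, mixD, mul_assoc, ← pow_succ]
  rw [← this]; rfl

theorem VT_of_mixD {p : Fin 3 → ℂ} {m : ℕ} {f : MvPolynomial (Fin 3) ℂ}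
    (h : ∀ b c, b + c < m → MvPolynomial.eval p (mixD b c f) = 0) : VT p m f := by
  induction m generalizing f with
  | zero => trivial
  | succ m ih =>
    refine ⟨by simpa [mixD] using h 0 0 (by simp), ih fun b c hbc => ?_, ih fun b c hbc => ?_⟩
    · rw [mixD_1]; exact h _ _ (by omega)
    · rw [mixD_2]; exact h _ _ (by omega)

theorem finrank_hom_ge (d : ℕ) :
    (d + 2).choose 2 ≤ Module.finrank ℂ (MvPolynomial.homogeneousSubmodule (Fin 3) ℂ d) := by
  have hfd : FiniteDimensional ℂ (MvPolynomial.homogeneousSubmodule (Fin 3) ℂ d) :=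
    Module.Finite.iff_fg.2 (MvPolynomial.homogeneousSubmodule_fg _ _ d)
  let v : ↥(Finset.finsuppAntidiag (Finset.univ : Finset (Fin 3)) d) →
      MvPolynomial.homogeneousSubmodule (Fin 3) ℂ d := fun k =>
    ⟨MvPolynomial.monomial k.1 1, by
      apply MvPolynomial.isHomogeneous_monomial
      have := (Finset.mem_finsuppAntidiag.1 k.2).1
      rw [Finsupp.degree_eq_sum]; exact this⟩
  have hv : LinearIndependent ℂ v := by
    apply LinearIndependent.of_comp (MvPolynomial.homogeneousSubmodule (Fin 3) ℂ d).subtype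
    have := (MvPolynomial.basisMonomials (Fin 3) ℂ).linearIndependent.comp
      (fun k : ↥(Finset.finsuppAntidiag (Finset.univ : Finset (Fin 3)) d) => k.1) Subtype.val_injective
    convert this using 1
    funext k
    simp [v]
  have := hv.fintype_card_le_finrank
  rw [Fintype.card_coe, Finset.card_finsuppAntidiag_nat_eq_choose] at this
  simp only [Finset.card_univ, Fintype.card_fin] at this
  rw [show 3 + d - 1 = d + 2 by omega, show (d+2).choose d = (d+2).choose 2 from
    Nat.choose_symm_of_eq_add rfl] at this
  exact this

theorem sum_sub_fin (m : ℕ) : 2 * ∑ b : Fin m, (m - (b : ℕ)) = m * (m + 1) := by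
  rw [Fin.sum_univ_eq_sum_range (fun b => m - b) m]
  induction m with
  | zero => simp
  | succ m ih =>
    rw [Finset.sum_range_succ']
    simp only [Nat.add_sub_add_right, mul_add, ih]
    simp; ring

theorem lower (d s : ℕ) (m : Fin s → ℕ) (tp : Fin s → ℂ) :
    ((d : ℤ) + 2) * (d + 1) - ∑ i, (m i : ℤ) * (m i + 1) ≤ 2 * (Module.finrank ℂ (linSys 2 d s m tp) : ℤ) := by
  have hfd : FiniteDimensional ℂ (MvPolynomial.homogeneousSubmodule (Fin 3) ℂ d) :=
    Module.Finite.iff_fg.2 (MvPolynomial.homogeneousSubmodule_fg _ _ d)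
  let Φ : MvPolynomial.homogeneousSubmodule (Fin 3) ℂ d →ₗ[ℂ]
      ((Σ i : Fin s, Σ b : Fin (m i), Fin (m i - (b : ℕ))) → ℂ) :=
    LinearMap.pi fun x => (MvPolynomial.aeval (rncPoint 2 (tp x.1))).toLinearMap ∘ₗ
      mixD (x.2.1 : ℕ) (x.2.2 : ℕ) ∘ₗ (MvPolynomial.homogeneousSubmodule (Fin 3) ℂ d).subtype
  have h1 : (LinearMap.ker Φ).map (MvPolynomial.homogeneousSubmodule (Fin 3) ℂ d).subtype ≤ linSys 2 d s m tp := by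
    rintro _ ⟨f, hf, rfl⟩
    refine mem_linSys.2 ⟨f.2, fun i => VO_of_VT (d := d) (by simp [rncPoint]) f.2 (VT_of_mixD fun b c hbc => ?_)⟩
    have := congrFun (LinearMap.mem_ker.1 hf) ⟨i, ⟨b, by omega⟩, ⟨c, by simp only; omega⟩⟩
    exact this
  have h2 : Module.finrank ℂ (LinearMap.ker Φ) ≤ Module.finrank ℂ (linSys 2 d s m tp) := by
    rw [← Submodule.finrank_map_subtype_eq]
    exact Submodule.finrank_mono h1
  have h3 := LinearMap.finrank_range_add_finrank_ker Φ
  have h4 := finrank_hom_ge d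
  have h5 : Module.finrank ℂ (LinearMap.range Φ) ≤ ∑ i, ∑ b : Fin (m i), (m i - (b : ℕ)) := by
    refine (Submodule.finrank_le _).trans ?_
    simp
  have h6 : 2 * ∑ i, ∑ b : Fin (m i), (m i - (b : ℕ)) = ∑ i, m i * (m i + 1) := by
    rw [Finset.mul_sum]; exact Finset.sum_congr rfl fun i _ => sum_sub_fin _
  have h7 : 2 * (d+2).choose 2 = (d + 2) * (d + 1) := by
    rw [Nat.choose_two_right, Nat.mul_div_cancel']
    · rfl
    · exact (Nat.even_mul_pred_self _).two_dvd
  have h8 : (d + 2) * (d + 1) ≤ ∑ i, m i * (m i + 1) + 2 * Module.finrank ℂ (linSys 2 d s m tp) := by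
    omega
  zify at h8
  linarith

theorem sum_redu_le {s : ℕ} (d : ℕ) (m : Fin s → ℕ) (hd : 2 ≤ d) (h1 : ∀ i, m i + 1 ≤ d)
    (h2 : ∀ i j, i ≠ j → m i + m j ≤ d) (h3 : ∑ i, m i ≤ 2 * d) :
    ∑ i, (m i - 1) + 4 ≤ 2 * d := by
  let T := Finset.univ.filter fun i => 1 ≤ m i
  have hT : ∑ i, (m i - 1) = ∑ i ∈ T, (m i - 1) := by
    symm
    apply Finset.sum_subset (Finset.subset_univ _)
    intro i _ hi
    simp only [T, Finset.mem_filter, Finset.mem_univ, true_and] at hi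
    omega
  have hT2 : ∑ i ∈ T, (m i - 1) + T.card = ∑ i ∈ T, m i := by
    rw [Finset.card_eq_sum_ones, ← Finset.sum_add_distrib]
    apply Finset.sum_congr rfl
    intro i hi
    simp only [T, Finset.mem_filter] at hi
    omega
  have hT3 : ∑ i ∈ T, m i ≤ ∑ i, m i := Finset.sum_le_sum_of_subset (Finset.subset_univ _)
  rw [hT]
  by_cases h4 : 4 ≤ T.card
  · omega
  have hc : T.card = 0 ∨ T.card = 1 ∨ T.card = 2 ∨ T.card = 3 := by omega
  rcases hc with hc | hc | hc | hc
  · rw [Finset.card_eq_zero.1 hc]; simp; omega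
  · obtain ⟨a, ha⟩ := Finset.card_eq_one.1 hc
    rw [ha]; simp; have := h1 a; omega
  · obtain ⟨a, b, hab, ha⟩ := Finset.card_eq_two.1 hc
    rw [ha, Finset.sum_pair hab]
    have := h2 a b hab; have := h1 a; have := h1 b; omega
  · obtain ⟨a, b, c, hab, hac, hbc, ha⟩ := Finset.card_eq_three.1 hc
    have hh := hT2
    rw [hc] at hh
    have : ∑ i ∈ T, m i = m a + m b + m c := by
      rw [ha, Finset.sum_insert (by simp [hab, hac]), Finset.sum_pair hbc]; ring
    have := h2 a b hab; have := h2 a c hac; have := h2 b c hbc; omega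

theorem redu_univ {s : ℕ} (m : Fin s → ℕ) : redu Finset.univ m = fun i => m i - 1 := by
  funext i; simp [redu]

theorem sum_pair_redu {s : ℕ} (m : Fin s → ℕ) (F : ℕ → ℤ) {i j : Fin s} (hij : i ≠ j) :
    ∑ l, F (redu {i, j} m l) = ∑ l, F (m l) + (F (m i - 1) - F (m i)) + (F (m j - 1) - F (m j)) := by
  have h : ∀ l, F (redu {i, j} m l) = F (m l) + (if l = i then F (m i - 1) - F (m i) else 0)
      + (if l = j then F (m j - 1) - F (m j) else 0) := by
    intro l
    simp only [redu, Finset.mem_insert, Finset.mem_singleton]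
    by_cases h1 : l = i
    · subst h1; simp [hij]
    · by_cases h2 : l = j
      · subst h2; simp [h1]
      · simp [h1, h2]
  rw [Finset.sum_congr rfl fun l _ => h l, Finset.sum_add_distrib, Finset.sum_add_distrib]
  simp

theorem finrank_zero_le (s : ℕ) (m : Fin s → ℕ) (tp : Fin s → ℂ) :
    Module.finrank ℂ (linSys 2 0 s m tp) ≤ 1 := by
  refine (Submodule.finrank_mono (t := Submodule.span ℂ {1}) ?_).trans ?_
  · intro f hf
    have h := (mem_linSys.1 hf).1
    rw [← MvPolynomial.totalDegree_zero_iff_isHomogeneous, MvPolynomial.totalDegree_eq_zero_iff_eq_C] at h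
    rw [h, Submodule.mem_span_singleton]
    exact ⟨_, by rw [MvPolynomial.smul_eq_C_mul, mul_one]⟩
  · exact (finrank_span_le_card _).trans (by simp)

theorem upper_nef {s : ℕ} (hs : 5 ≤ s) {tp : Fin s → ℂ} (htp : Function.Injective tp) (d : ℕ) :
    ∀ (m : Fin s → ℕ), (∀ i j, i ≠ j → m i + m j ≤ d) → ∑ i, m i ≤ 2 * d →
    2 * (Module.finrank ℂ (linSys 2 d s m tp) : ℤ) ≤ ((d : ℤ) + 2) * (d + 1) - ∑ i, (m i : ℤ) * (m i + 1) := by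
  induction d using Nat.strong_induction_on with
  | _ d ih =>
  intro m h1 h2
  have hne : ∀ i : Fin s, ∃ j, i ≠ j := by
    intro i
    by_cases h : i = ⟨0, by omega⟩
    · exact ⟨⟨1, by omega⟩, by rw [h]; simp⟩
    · exact ⟨_, h⟩
  have hmd : ∀ i, m i ≤ d := by
    intro i
    obtain ⟨j, hj⟩ := hne i
    have := h1 i j hj; omega
  have hline : ∀ i j : Fin s, i ≠ j → m i + m j = d ∨ (d = 1 ∧ m i = 0) → m j = 0 → 1 ≤ d →
      (∀ l, l ≠ i → m l = 0) →
      2 * (Module.finrank ℂ (linSys 2 d s m tp) : ℤ) ≤ ((d : ℤ) + 2) * (d + 1) - ∑ i, (m i : ℤ) * (m i + 1) := by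
    intro i j hij hd hj hd1 hl
    have hu := (lineData htp i j).upper htp d m
    rw [Finset.sum_pair hij] at hu
    have hr : ∀ l, redu {i, j} m l = if l = i then m i - 1 else 0 := by
      intro l
      simp only [redu, Finset.mem_insert, Finset.mem_singleton]
      by_cases h3 : l = i
      · subst h3; simp
      · by_cases h4 : l = j
        · subst h4; simp [hj, h3]
        · simp [h3, h4, hl l h3]
    have hi := ih (d - 1) (by omega) (redu {i, j} m) (by
      intro a b hab
      rw [hr, hr]
      have : ¬ (a = i ∧ b = i) := fun h => hab (h.1.trans h.2.symm)
      split_ifs <;> first | omega | tauto) (by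
      simp only [hr, Finset.sum_ite_eq', Finset.mem_univ, if_true]
      omega)
    have hsum := sum_pair_redu m (fun n => (n : ℤ) * (n + 1)) hij
    rw [hsum] at hi
    rw [hj] at hi hu
    generalize Module.finrank ℂ (linSys 2 (d - 1) s (redu {i, j} m) tp) = X at hi hu
    obtain ⟨e, rfl⟩ : ∃ e, d = e + 1 := ⟨d - 1, by omega⟩
    simp only [Nat.add_sub_cancel] at hi
    rcases hd with hd | ⟨hd, hmi⟩
    · rw [hj, add_zero] at hd
      rw [hd] at hi hu
      simp only [Nat.add_sub_cancel] at hi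
      have hu' : Module.finrank ℂ (linSys 2 (e+1) s m tp) ≤ X + 1 := by
        omega
      zify at hu'
      push_cast at hi ⊢
      linarith
    · have he : e = 0 := by omega
      subst he
      rw [hmi] at hi hu
      have hu' : Module.finrank ℂ (linSys 2 (0+1) s m tp) ≤ X + 2 := by
        omega
      zify at hu'
      push_cast at hi ⊢
      simp at hi ⊢
      linarith
  by_cases hex : ∃ i, m i = d
  · obtain ⟨i, hi⟩ := hex
    have hl : ∀ l, l ≠ i → m l = 0 := by
      intro l hl
      have := h1 l i hl; omega
    rcases Nat.eq_zero_or_pos d with h0 | h0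
    · subst h0
      have hz : ∀ l, m l = 0 := fun l => by have := hmd l; omega
      have := finrank_zero_le s m tp
      simp only [hz]
      zify at this
      simp; linarith
    · obtain ⟨j, hj⟩ := hne i
      exact hline i j hj (by left; rw [hi, hl j hj.symm]; rfl) (hl j hj.symm) h0 hl
  · push Not at hex
    have hlt : ∀ i, m i + 1 ≤ d := fun i => by have := hmd i; have := hex i; omega
    have hd1 : 1 ≤ d := by have := hlt ⟨0, by omega⟩; omega
    by_cases hd : d = 1
    · have hz : ∀ l, m l = 0 := fun l => by have := hlt l; omega
      obtain ⟨j, hj⟩ := hne ⟨0, by omega⟩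
      exact hline _ j hj (Or.inr ⟨hd, hz _⟩) (hz _) hd1 fun l _ => hz l
    · have hd2 : 2 ≤ d := by omega
      have hu := (conicData s tp).upper htp d m
      rw [redu_univ] at hu
      have hi := ih (d - 2) (by omega) (fun i => m i - 1) (by
        intro a b hab
        have := h1 a b hab; have := hlt a; have := hlt b
        omega) (by
        have := sum_redu_le d m hd2 hlt h1 h2
        omega)
      have hsum : ∑ i, ((m i - 1 : ℕ) : ℤ) * (((m i - 1 : ℕ) : ℤ) + 1)
          = ∑ i, (m i : ℤ) * (m i + 1) - 2 * ∑ i, (m i : ℤ) := by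
        rw [Finset.mul_sum, ← Finset.sum_sub_distrib]
        refine Finset.sum_congr rfl fun i _ => ?_
        rcases Nat.eq_zero_or_pos (m i) with h0 | h0
        · simp [h0]
        · rw [Nat.cast_sub h0]; push_cast; ring
      rw [hsum] at hi
      have hu' : Module.finrank ℂ (linSys 2 d s m tp) + ∑ i, m i ≤
        Module.finrank ℂ (linSys 2 (d-2) s (fun i => m i - 1) tp) + 2 * d + 1 := by omega
      zify at hu'
      rw [Nat.cast_sub hd2] at hi
      push_cast at hi
      nlinarith

theorem Cb_two (k : ℤ) : 2 * Cb k 2 = if 0 ≤ k then k * (k - 1) else 0 := by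
  unfold Cb
  split_ifs with h1 h2 h2
  · obtain ⟨n, rfl⟩ := Int.eq_ofNat_of_zero_le h2
    have h7 : 2 * n.choose 2 = n * (n - 1) := by
      rw [Nat.choose_two_right, Nat.mul_div_cancel']
      exact (Nat.even_mul_pred_self _).two_dvd
    have hn : 1 ≤ n := by omega
    simp only [Int.toNat_natCast, show (2 : ℤ).toNat = 2 from rfl]
    zify [hn] at h7
    exact h7
  · omega
  · have : k = 0 ∨ k = 1 := by omega
    rcases this with rfl | rfl <;> simp
  · rfl

theorem Cb_one (k : ℤ) : Cb k 1 = if 0 ≤ k then k else 0 := by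
  unfold Cb
  split_ifs with h1 h2 h2
  · simp [h2]
  · omega
  · omega
  · rfl

/-- sum over pairs -/
def pairSum {s : ℕ} (d : ℕ) (m : Fin s → ℕ) : ℤ :=
  ∑ p ∈ Finset.univ.filter (fun p : Fin s × Fin s => p.1 < p.2), Cb ((m p.1 : ℤ) + (m p.2 : ℤ) - d) 2

theorem mult_le_deg {s : ℕ} {tp : Fin s → ℂ} (htp : Function.Injective tp) (i j : Fin s) (hij : i ≠ j) (d : ℕ) :
    ∀ (m : Fin s → ℕ), linSys 2 d s m tp ≠ ⊥ → m i ≤ d := by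
  induction d with
  | zero =>
    intro m heff
    by_contra h
    have := ((lineData htp i j).equal htp 0 m heff (by rw [Finset.sum_pair hij]; omega)).1
    omega
  | succ d ih =>
    intro m heff
    by_contra h
    have h2 := ((lineData htp i j).equal htp (d+1) m heff (by rw [Finset.sum_pair hij]; omega)).2.1
    have := ih _ h2
    simp [redu] at this
    omega

theorem pairSum_line {s : ℕ} (d : ℕ) (m : Fin s → ℕ) (i j : Fin s) (hij : i < j) (hd : 1 ≤ d)
    (hi : 1 ≤ m i) (hj : 1 ≤ m j) (hgt : d < m i + m j) (hsum : ∑ i, m i ≤ 2 * d) :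
    pairSum d m = pairSum (d - 1) (redu {i, j} m) + ((m i : ℤ) + m j - d - 1) := by
  have hmem : (i, j) ∈ Finset.univ.filter (fun p : Fin s × Fin s => p.1 < p.2) := by simpa using hij
  unfold pairSum
  rw [← Finset.add_sum_erase _ _ hmem, ← Finset.add_sum_erase _ _ hmem]
  have h1 : ∀ p ∈ (Finset.univ.filter (fun p : Fin s × Fin s => p.1 < p.2)).erase (i, j),
      Cb ((m p.1 : ℤ) + (m p.2 : ℤ) - d) 2 =
      Cb ((redu {i, j} m p.1 : ℤ) + (redu {i, j} m p.2 : ℤ) - (d - 1 : ℕ)) 2 := by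
    rintro ⟨a, b⟩ hp
    simp only [Finset.mem_erase, Finset.mem_filter, Finset.mem_univ, true_and, ne_eq, Prod.mk.injEq] at hp
    obtain ⟨hne, hab⟩ := hp
    by_cases ha : a = i ∨ a = j
    · have hb : ¬ (b = i ∨ b = j) := by
        rintro (rfl | rfl) <;> rcases ha with rfl | rfl
        · exact absurd hab (lt_irrefl _)
        · exact absurd hab (not_lt.2 hij.le)
        · exact hne ⟨rfl, rfl⟩
        · exact absurd hab (lt_irrefl _)
      have hm : 1 ≤ m a := by rcases ha with rfl | rfl <;> assumption
      congr 1
      simp only [redu, Finset.mem_insert, Finset.mem_singleton, if_pos ha, if_neg hb]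
      omega
    · by_cases hb : b = i ∨ b = j
      · have hm : 1 ≤ m b := by rcases hb with rfl | rfl <;> assumption
        congr 1
        simp only [redu, Finset.mem_insert, Finset.mem_singleton, if_neg ha, if_pos hb]
        omega
      · simp only [redu, Finset.mem_insert, Finset.mem_singleton, if_neg ha, if_neg hb]
        push Not at ha hb
        have h4 : m i + m j + m a + m b ≤ ∑ i, m i := by
          have : ∑ l ∈ ({i, j, a, b} : Finset (Fin s)), m l ≤ ∑ l, m l :=
            Finset.sum_le_sum_of_subset (Finset.subset_univ _)
          rw [Finset.sum_insert (by simp [hij.ne, ha.1.symm, hb.1.symm]),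
            Finset.sum_insert (by simp [ha.2.symm, hb.2.symm]), Finset.sum_pair hab.ne] at this
          omega
        have e1 : Cb ((m a : ℤ) + (m b : ℤ) - d) 2 = 0 := by
          unfold Cb; rw [if_neg]; omega
        have e2 : Cb ((m a : ℤ) + (m b : ℤ) - (d - 1 : ℕ)) 2 = 0 := by
          unfold Cb; rw [if_neg]; omega
        rw [e1, e2]
  rw [Finset.sum_congr rfl h1]
  have h2 : Cb ((m i : ℤ) + (m j : ℤ) - d) 2 =
      Cb ((redu {i, j} m i : ℤ) + (redu {i, j} m j : ℤ) - (d - 1 : ℕ)) 2 + ((m i : ℤ) + m j - d - 1) := by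
    have e1 := Cb_two ((m i : ℤ) + (m j : ℤ) - d)
    have e2 := Cb_two ((m i : ℤ) + (m j : ℤ) - d - 1)
    rw [if_pos (by omega)] at e1 e2
    have e3 : (redu {i, j} m i : ℤ) + (redu {i, j} m j : ℤ) - (d - 1 : ℕ) = (m i : ℤ) + (m j : ℤ) - d - 1 := by
      simp only [redu, Finset.mem_insert, Finset.mem_singleton, true_or, or_true, if_true]
      omega
    rw [e3]
    linarith
  simp only
  rw [h2]
  ring

theorem no_conic {s : ℕ} (hs : 5 ≤ s) {tp : Fin s → ℂ} (htp : Function.Injective tp) (d : ℕ) :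
    ∀ (m : Fin s → ℕ), linSys 2 d s m tp ≠ ⊥ → ∑ i, m i ≤ 2 * d →
    2 * (Module.finrank ℂ (linSys 2 d s m tp) : ℤ) =
      ((d : ℤ) + 2) * (d + 1) - ∑ i, (m i : ℤ) * (m i + 1) + 2 * pairSum d m := by
  induction d using Nat.strong_induction_on with
  | _ d ih =>
  intro m heff h2
  by_cases h1 : ∀ i j, i ≠ j → m i + m j ≤ d
  · have hp : pairSum d m = 0 := by
      apply Finset.sum_eq_zero
      rintro ⟨a, b⟩ hab
      simp only [Finset.mem_filter, Finset.mem_univ, true_and] at hab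
      have := h1 a b hab.ne
      unfold Cb; rw [if_neg]; simp only; omega
    rw [hp]
    have := lower d s m tp
    have := upper_nef hs htp d m h1 h2
    linarith
  · have h1' : ∃ i j, i < j ∧ d < m i + m j := by
      push Not at h1
      obtain ⟨i, j, hij, h⟩ := h1
      rcases lt_or_gt_of_ne hij with h' | h'
      · exact ⟨i, j, h', h⟩
      · exact ⟨j, i, h', by omega⟩
    obtain ⟨i, j, hij, hgt⟩ := h1'
    obtain ⟨hd, hb, heq⟩ := (lineData htp i j).equal htp d m heff (by rw [Finset.sum_pair hij.ne]; omega)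
    have hmi := mult_le_deg htp i j hij.ne d m heff
    have hmj := mult_le_deg htp j i hij.ne' d m heff
    have hi1 : 1 ≤ m i := by omega
    have hj1 : 1 ≤ m j := by omega
    have hs1 := sum_pair_redu m (fun n => (n : ℤ)) hij.ne
    have hs2 := sum_pair_redu m (fun n => (n : ℤ) * (n + 1)) hij.ne
    rw [Nat.cast_sub hi1, Nat.cast_sub hj1] at hs1 hs2
    have hle : ∑ l, redu {i, j} m l ≤ 2 * (d - 1) := by
      zify [hd]
      zify at h2
      rw [hs1]
      push_cast
      linarith
    have hi := ih (d - 1) (by omega) _ hb hle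
    rw [heq, hi, pairSum_line d m i j hij hd hi1 hj1 hgt h2, hs2, Nat.cast_sub hd]
    push_cast
    ring

theorem with_conic {s : ℕ} (hs : 5 ≤ s) {tp : Fin s → ℂ} (htp : Function.Injective tp) (ε : ℕ)
    (hε : (ε : ℤ) ≤ (s : ℤ) - 5) (k : ℕ) :
    ∀ (d : ℕ) (m : Fin s → ℕ), linSys 2 d s m tp ≠ ⊥ → (∀ i, k ≤ m i) →
    ((s : ℤ) - 4) * k = (∑ i, (m i : ℤ)) - 2 * d + ε →
    2 * (Module.finrank ℂ (linSys 2 d s m tp) : ℤ) =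
      ((d : ℤ) + 2) * (d + 1) - ∑ i, (m i : ℤ) * (m i + 1) + 2 * pairSum d m
        + k * (k - 1) + ((s : ℤ) - 5) * ((k + 1) * k) - 2 * ε * k := by
  induction k with
  | zero =>
    intro d m heff _ h
    have := no_conic hs htp d m heff (by zify; push_cast at h; linarith)
    rw [this]; push_cast; ring
  | succ k ih =>
    intro d m heff hm h
    push_cast at h
    have hlt : 2 * d < ∑ i, m i := by
      zify
      have hs' : (5 : ℤ) ≤ s := by exact_mod_cast hs
      have : 0 ≤ ((s : ℤ) - 4) * k := mul_nonneg (by linarith) (by positivity)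
      linarith
    obtain ⟨hd, hb, heq⟩ := (conicData s tp).equal htp d m heff hlt
    rw [redu_univ] at hb heq
    have hc : ∀ i, ((m i - 1 : ℕ) : ℤ) = (m i : ℤ) - 1 := fun i => by
      have := hm i; omega
    have hi := ih (d - 2) _ hb (fun i => by have := hm i; omega) (by
      simp only [hc, Nat.cast_sub hd, Finset.sum_sub_distrib]
      simp
      linarith)
    have hp : pairSum (d - 2) (fun i => m i - 1) = pairSum d m := by
      unfold pairSum
      refine Finset.sum_congr rfl fun p _ => ?_
      simp only [hc, Nat.cast_sub hd]
      congr 1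
      push_cast; ring
    have hq : ∑ i, ((m i - 1 : ℕ) : ℤ) * (((m i - 1 : ℕ) : ℤ) + 1)
        = ∑ i, (m i : ℤ) * (m i + 1) - 2 * ∑ i, (m i : ℤ) := by
      rw [Finset.mul_sum, ← Finset.sum_sub_distrib]
      refine Finset.sum_congr rfl fun i _ => ?_
      rw [hc]; ring
    rw [heq, hi, hp, hq, Nat.cast_sub hd]
    push_cast
    linear_combination (-2) * h


/-- **The planar case (Proposition A).** For `s ≥ 5` points on a smooth conic in `ℙ²`,
if `L = L_{2,d}(m_1,…,m_s)` is effective and non-redundant then `dim L = G`, where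
`G = C(d+2,2) − Σᵢ C(mᵢ+1,2) + Σ_{i<j} C(k_{ij},2) + C(k_C,2) + (s−5)C(k_C+1,2) − ε·C(k_C,1)`. -/
theorem stmt_1 (d s : ℕ) (hs : 5 ≤ s)
    (m : Fin s → ℕ) (tp : Fin s → ℂ) (htp : Function.Injective tp)
    (heff : linSys 2 d s m tp ≠ ⊥)
    (hred : ∀ i : Fin s, kC 2 d s m ≤ (m i : ℤ))
    (ε : ℕ) (hε : (ε : ℤ) ≤ (s : ℤ) - 5)
    (hεdef : ((s : ℤ) - 4) * kC 2 d s m = (∑ i, (m i : ℤ)) - 2 * d + ε) :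
    (Module.finrank ℂ (linSys 2 d s m tp) : ℤ) =
      Cb ((d : ℤ) + 2) 2 - ∑ i, Cb ((m i : ℤ) + 1) 2
        + ∑ p ∈ Finset.univ.filter (fun p : Fin s × Fin s => p.1 < p.2),
            Cb ((m p.1 : ℤ) + (m p.2 : ℤ) - d) 2
        + Cb (kC 2 d s m) 2 + ((s : ℤ) - 5) * Cb (kC 2 d s m + 1) 2
        - (ε : ℤ) * Cb (kC 2 d s m) 1 := by
  have h2 : ∀ a b : ℤ, 2 * a = 2 * b → a = b := fun a b h => by linarith
  apply h2
  have hd := Cb_two ((d : ℤ) + 2)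
  rw [if_pos (by omega)] at hd
  have hm : 2 * ∑ i, Cb ((m i : ℤ) + 1) 2 = ∑ i, (m i : ℤ) * (m i + 1) := by
    rw [Finset.mul_sum]
    refine Finset.sum_congr rfl fun i _ => ?_
    rw [Cb_two, if_pos (by omega)]; ring
  have hp : ∑ p ∈ Finset.univ.filter (fun p : Fin s × Fin s => p.1 < p.2),
            Cb ((m p.1 : ℤ) + (m p.2 : ℤ) - d) 2 = pairSum d m := rfl
  rw [hp]
  generalize kC 2 d s m = k at *
  by_cases hk : 0 ≤ k
  · obtain ⟨n, rfl⟩ := Int.eq_ofNat_of_zero_le hk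
    have h := with_conic hs htp ε hε n d m heff (fun i => by exact_mod_cast hred i) hεdef
    have e1 := Cb_two (n : ℤ)
    have e2 := Cb_two ((n : ℤ) + 1)
    have e3 := Cb_one (n : ℤ)
    rw [if_pos (by omega)] at e1 e2 e3
    rw [h, e3]
    linear_combination (-1) * hd + hm - e1 - ((s : ℤ) - 5) * e2
  · have hle : ∑ i, m i ≤ 2 * d := by
      zify
      have hs' : (5 : ℤ) ≤ s := by exact_mod_cast hs
      have : 0 ≤ ((s : ℤ) - 4) * (-k) := mul_nonneg (by linarith) (by linarith)
      linarith
    have h := no_conic hs htp d m heff hle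
    have e1 : Cb k 2 = 0 := by unfold Cb; rw [if_neg]; omega
    have e2 : Cb (k + 1) 2 = 0 := by unfold Cb; rw [if_neg]; omega
    have e3 : Cb k 1 = 0 := by unfold Cb; rw [if_neg]; omega
    rw [h, e1, e2, e3]
    linear_combination (-1) * hd + hm

end
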